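/- The set FullL is suffixient for the text T[1..n]. -/

import Mathlib

open scoped Classical

/-- `seg T i len` is the string `T[i..i+len-1]`. -/
def seg (T : ℕ → ℤ) (i len : ℕ) : List ℤ :=
  (List.range len).map fun k => T (i + k)

/-- `sfx T n p` is the suffix `T[p..n]` of a length-`n` text. -/
def sfx (T : ℕ → ℤ) (n p : ℕ) : List ℤ := seg T p (n + 1 - p)

/-- The reversed text: `Trev T n n = T n` and `Trev T n i = T (n - i)` for `i < n`. -/
def Trev (T : ℕ → ℤ) (n : ℕ) : ℕ → ℤ := fun i => if i = n then T n else T (n - i)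

/-- Length of the longest common prefix of two strings. -/
def lcpLen : List ℤ → List ℤ → ℕ
  | a :: l₁, b :: l₂ => if a = b then lcpLen l₁ l₂ + 1 else 0
  | _, _ => 0

/-- `s` occurs as a substring of `T[1..n]`. -/
def OccursIn (T : ℕ → ℤ) (n : ℕ) (s : List ℤ) : Prop :=
  ∃ i : ℕ, 1 ≤ i ∧ i + s.length ≤ n + 1 ∧ s = seg T i s.length

/-- `s` is a right-maximal substring of `T[1..n]` over the alphabet `{1,…,σ}`. -/
def RightMax (T : ℕ → ℤ) (n σ : ℕ) (s : List ℤ) : Prop :=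
  ∃ a b : ℤ, a ≠ b ∧ 1 ≤ a ∧ a ≤ (σ : ℤ) ∧ 1 ≤ b ∧ b ≤ (σ : ℤ) ∧
    OccursIn T n (s ++ [a]) ∧ OccursIn T n (s ++ [b])

/-- `X` is a suffixient set for `T[1..n]`. -/
def Suffixient (T : ℕ → ℤ) (n σ : ℕ) (X : Set ℕ) : Prop :=
  ∀ s : List ℤ, RightMax T n σ s → ∀ c : ℤ, 1 ≤ c → c ≤ (σ : ℤ) →
    OccursIn T n (s ++ [c]) → ∃ x ∈ X, (s ++ [c]) <:+ seg T 1 x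

def StartRun (BWT : ℕ → ℤ) (x : ℕ) : Prop := 1 < x ∧ BWT x ≠ BWT (x - 1)

def EndRun (BWT : ℕ → ℤ) (n x : ℕ) : Prop := x < n ∧ BWT x ≠ BWT (x + 1)

def RunBoundary (BWT : ℕ → ℤ) (n x : ℕ) : Prop := StartRun BWT x ∨ EndRun BWT n x

/-- `bIdx L x` : the largest index `y < x` with `L y < L x`, or `1` if none exists. -/
noncomputable def bIdx (L : ℕ → ℤ) (x : ℕ) : ℕ :=
  sSup {y : ℕ | (1 ≤ y ∧ y < x ∧ L y < L x) ∨ y = 1}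

/-- `eIdx L n x` : the smallest index `y > x` with `L y < L x`, or `n+1` if none exists. -/
noncomputable def eIdx (L : ℕ → ℤ) (n x : ℕ) : ℕ :=
  sInf {y : ℕ | (x < y ∧ y ≤ n ∧ L y < L x) ∨ y = n + 1}

/-- The maximal weight `w y` over indices `a ≤ y < a'` with `BWT y = c` and `w y ≥ 0`. -/
noncomputable def wMax (BWT w : ℕ → ℤ) (c : ℤ) (a a' : ℕ) : ℤ :=
  (sSup {m : ℕ | ∃ q : ℕ, a ≤ q ∧ q < a' ∧ BWT q = c ∧ 0 ≤ w q ∧ (m : ℤ) = w q} : ℕ)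

/-- `Candt BWT w c a a'`: the smallest index `a ≤ p < a'` with `BWT p = c` whose weight
attains the maximum weight among such indices; `-1` if no index
`a ≤ y < a'` with `BWT y = c` and `w y ≥ 0` exists. -/
noncomputable def Candt (BWT w : ℕ → ℤ) (c : ℤ) (a a' : ℕ) : ℤ :=
  if ∃ p : ℕ, a ≤ p ∧ p < a' ∧ BWT p = c ∧ 0 ≤ w p then
    ((sInf {p : ℕ | a ≤ p ∧ p < a' ∧ BWT p = c ∧ w p = wMax BWT w c a a'} : ℕ) : ℤ)
  else -1

def FullL (n : ℕ) (SA : ℕ → ℕ) (BWT LCP w : ℕ → ℤ) : Set ℕ :=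
  { q | ∃ x : ℕ, 1 < x ∧ x ≤ n ∧ BWT x ≠ BWT (x - 1) ∧
      ∃ c : ℤ, (c = BWT x ∨ c = BWT (x - 1)) ∧
      ∃ p : ℕ, (p : ℤ) = Candt BWT w c (bIdx LCP x) (eIdx LCP n x) ∧
        q = n - SA p + 1 }

/-- Basic assumptions on the text `T[1..n]` over alphabet `{1,…,σ}` with sentinel `dollar`. -/
structure TextSetup (n σ : ℕ) (T : ℕ → ℤ) (dollar : ℤ) : Prop where
  hn : 2 ≤ n
  hsigma : 2 ≤ σ
  hsigma_le : σ ≤ n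
  hT : ∀ i, 1 ≤ i → i ≤ n → 1 ≤ T i ∧ T i ≤ (σ : ℤ)
  hTn : T n = dollar
  hTne : ∀ i, 1 ≤ i → i < n → T i ≠ dollar

/-- `SA[1..n]` is the suffix array of the reversed text. -/
structure SASetup (n σ : ℕ) (T : ℕ → ℤ) (dollar : ℤ) (SA : ℕ → ℕ)
    extends TextSetup n σ T dollar : Prop where
  hSAmem : ∀ i, 1 ≤ i → i ≤ n → 1 ≤ SA i ∧ SA i ≤ n
  hSAinj : ∀ i j, 1 ≤ i → i ≤ n → 1 ≤ j → j ≤ n → SA i = SA j → i = j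
  hSAsurj : ∀ p, 1 ≤ p → p ≤ n → ∃ i, 1 ≤ i ∧ i ≤ n ∧ SA i = p
  hSAord : ∀ i j, 1 ≤ i → i < j → j ≤ n →
    List.Lex (· < ·) (sfx (Trev T n) n (SA i)) (sfx (Trev T n) n (SA j))

/-- `LCP[1..n]` is the LCP array of the reversed text. -/
structure LCPSetup (n σ : ℕ) (T : ℕ → ℤ) (dollar : ℤ) (SA : ℕ → ℕ) (LCP : ℕ → ℤ)
    extends SASetup n σ T dollar SA : Prop where
  hLCP1 : LCP 1 = -1
  hLCP : ∀ i, 1 < i → i ≤ n →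
    LCP i = (lcpLen (sfx (Trev T n) n (SA (i - 1))) (sfx (Trev T n) n (SA i)) : ℤ)
  hLCPend : LCP (n + 1) = -1

/-- Additionally, `BWT[1..n]` is the BWT of the reversed text and `w` is the weight function. -/
structure FullSetup (n σ : ℕ) (T : ℕ → ℤ) (dollar : ℤ) (SA : ℕ → ℕ)
    (BWT LCP w : ℕ → ℤ) extends LCPSetup n σ T dollar SA LCP : Prop where
  hBWT : ∀ i, 1 ≤ i → i ≤ n → BWT i = T (n - SA i + 1)
  hBWTend : BWT (n + 1) = -1
  hwNot : ∀ x, 1 ≤ x → x ≤ n → ¬ RunBoundary BWT n x → w x = -1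
  hwRB : ∀ x, 1 ≤ x → x ≤ n → RunBoundary BWT n x →
    (∃ s : List ℤ, RightMax T n σ s ∧ s <:+ seg T 1 (n - SA x)) →
    IsGreatest {m : ℤ | ∃ s : List ℤ, RightMax T n σ s ∧ s <:+ seg T 1 (n - SA x) ∧
      m = (s.length : ℤ)} (w x)

/-- `sIdx`: the minimum index `i ∈ [1..n]` such that `T[n-SA[ℓ]+1-w(ℓ)..n-SA[ℓ]]`
is a suffix of `T[1..n-SA[i]]`. -/
noncomputable def sIdx (T : ℕ → ℤ) (n : ℕ) (SA : ℕ → ℕ) (w : ℕ → ℤ) (l : ℕ) : ℕ :=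
  sInf {i : ℕ | 1 ≤ i ∧ i ≤ n ∧
    seg T (n - SA l + 1 - (w l).toNat) (w l).toNat <:+ seg T 1 (n - SA i)}

/-- `tIdx`: the maximum such index. -/
noncomputable def tIdx (T : ℕ → ℤ) (n : ℕ) (SA : ℕ → ℕ) (w : ℕ → ℤ) (l : ℕ) : ℕ :=
  sSup {i : ℕ | 1 ≤ i ∧ i ≤ n ∧
    seg T (n - SA l + 1 - (w l).toNat) (w l).toNat <:+ seg T 1 (n - SA i)}

/-- `pIdx c i`: the largest index `j < i` with `w j > -1` and `BWT j = c`, or `0`. -/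
noncomputable def pIdx (BWT w : ℕ → ℤ) (c : ℤ) (i : ℕ) : ℕ :=
  sSup {j : ℕ | (1 ≤ j ∧ j < i ∧ -1 < w j ∧ BWT j = c) ∨ j = 0}

/-- `pW c i`: the weight of `pIdx c i`, or `-1` if no index as in `pIdx` exists. -/
noncomputable def pW (BWT w : ℕ → ℤ) (c : ℤ) (i : ℕ) : ℤ :=
  if ∃ j : ℕ, 1 ≤ j ∧ j < i ∧ -1 < w j ∧ BWT j = c then w (pIdx BWT w c i) else -1

/-- `α` is colexicographically smaller than `β`. -/
def ColexLt (α β : List ℤ) : Prop :=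
  (α ≠ β ∧ α <:+ β) ∨
  ∃ k : ℕ, 1 ≤ k ∧ k ≤ α.length ∧ k ≤ β.length ∧
    (∀ i, 1 ≤ i → i < k → α.getD (α.length - i) 0 = β.getD (β.length - i) 0) ∧
    α.getD (α.length - k) 0 < β.getD (β.length - k) 0

theorem seg_one_succ (T : ℕ → ℤ) (m : ℕ) : seg T 1 (m + 1) = seg T 1 m ++ [T (m + 1)] := by
  simp [seg, List.range_succ, Nat.add_comm]

theorem length_seg (T : ℕ → ℤ) (i m : ℕ) : (seg T i m).length = m := by simp [seg]

theorem seg_suffix_seg_one (T : ℕ → ℤ) (i len : ℕ) (hi : 1 ≤ i) :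
    seg T i len <:+ seg T 1 (i + len - 1) := by
  induction len with
  | zero => simp [seg]
  | succ l ih =>
    obtain ⟨t, ht⟩ := ih
    have h1 : i + (l + 1) - 1 = (i + l - 1) + 1 := by omega
    have h2 : seg T i (l + 1) = seg T i l ++ [T (i + l)] := by simp [seg, List.range_succ]
    have h3 : i + l - 1 + 1 = i + l := by omega
    exact ⟨t, by rw [h1, seg_one_succ, h2, ← ht, h3, List.append_assoc]⟩

theorem eq_seg_of_suffix_seg_one {T : ℕ → ℤ} {m : ℕ} {s : List ℤ} (h : s <:+ seg T 1 m) :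
    s = seg T (m + 1 - s.length) s.length := by
  have hl : s.length ≤ m := by simpa [length_seg] using h.length_le
  have h' := seg_suffix_seg_one T (m + 1 - s.length) s.length (by omega)
  rw [show m + 1 - s.length + s.length - 1 = m by omega] at h'
  exact (List.suffix_of_suffix_length_le h h' (by simp [length_seg])).eq_of_length
    (by simp [length_seg])

theorem suffix_concat_iff_of_seg {T : ℕ → ℤ} {m : ℕ} {s : List ℤ} {a : ℤ} :
    s ++ [a] <:+ seg T 1 (m + 1) ↔ s <:+ seg T 1 m ∧ T (m + 1) = a := by
  rw [seg_one_succ]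
  constructor
  · rintro ⟨t, ht⟩
    rw [← List.append_assoc] at ht
    have := List.append_inj' ht rfl
    exact ⟨⟨t, this.1⟩, by simpa using this.2.symm⟩
  · rintro ⟨⟨t, ht⟩, rfl⟩
    exact ⟨t, by rw [← ht, List.append_assoc]⟩

/-- An occurrence of `s ++ [a]` is a proper prefix of the text ending in `s`, followed by `a`. -/
theorem occursIn_concat_iff {T : ℕ → ℤ} {n : ℕ} {s : List ℤ} {a : ℤ} :
    OccursIn T n (s ++ [a]) ↔ ∃ m < n, s <:+ seg T 1 m ∧ T (m + 1) = a := by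
  constructor
  · rintro ⟨i, hi, hin, h⟩
    simp only [List.length_append, List.length_singleton] at hin h
    refine ⟨i + s.length - 1, by omega, ?_⟩
    rw [← suffix_concat_iff_of_seg, h]
    rw [show i + s.length - 1 + 1 = i + (s.length + 1) - 1 by omega]
    exact seg_suffix_seg_one T i _ hi
  · rintro ⟨m, hm, h⟩
    rw [← suffix_concat_iff_of_seg] at h
    have hl : (s ++ [a]).length ≤ m + 1 := by simpa [length_seg] using h.length_le
    exact ⟨_, by omega, by omega, eq_seg_of_suffix_seg_one h⟩

theorem sfx_Trev (T : ℕ → ℤ) {n p : ℕ} (hp : p ≤ n) :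
    sfx (Trev T n) n p = (seg T 1 (n - p)).reverse ++ [T n] := by
  obtain ⟨d, rfl⟩ := Nat.exists_eq_add_of_le hp
  clear hp
  simp only [sfx, Nat.add_sub_cancel_left]
  rw [show p + d + 1 - p = d + 1 by omega]
  apply List.ext_getElem
  · simp [seg]
  · intro k h1 h2
    simp only [length_seg] at h1
    by_cases hk : k = d
    · subst hk
      simp [seg, Trev]
    · rw [List.getElem_append_left (by simp [length_seg]; omega)]
      simp only [seg, List.getElem_map, List.getElem_range, List.getElem_reverse, Trev,
        List.length_map, List.length_range]
      rw [if_neg (by omega)]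
      congr 1
      omega

theorem exists_common_prefix_length_eq_lcpLen (A B : List ℤ) :
    ∃ v : List ℤ, v.length = lcpLen A B ∧ v <+: A ∧ v <+: B := by
  induction A generalizing B with
  | nil => exact ⟨[], by simp [lcpLen]⟩
  | cons a A ih =>
    cases B with
    | nil => exact ⟨[], by simp [lcpLen]⟩
    | cons b B =>
      by_cases h : a = b
      · obtain ⟨v, hv, hA, hB⟩ := ih B
        exact ⟨a :: v, by simp [lcpLen, h, hv], by simpa using hA, by simp [h, hB]⟩
      · exact ⟨[], by simp [lcpLen, h]⟩

theorem length_le_lcpLen {u A B : List ℤ} (hA : u <+: A) (hB : u <+: B) :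
    u.length ≤ lcpLen A B := by
  induction u generalizing A B with
  | nil => simp
  | cons a u ih =>
    obtain ⟨A, rfl⟩ := hA
    obtain ⟨B, rfl⟩ := hB
    simpa [lcpLen] using ih (List.prefix_append u A) (List.prefix_append u B)

theorem prefix_iff_of_length_le_lcpLen {u A B : List ℤ} (h : u.length ≤ lcpLen A B) :
    u <+: A ↔ u <+: B := by
  obtain ⟨v, hv, hA, hB⟩ := exists_common_prefix_length_eq_lcpLen A B
  rw [← hv] at h
  exact ⟨fun hu => (List.prefix_of_prefix_length_le hu hA h).trans hB,
    fun hu => (List.prefix_of_prefix_length_le hu hB h).trans hA⟩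

theorem prefix_of_lex_of_lex {u A B C : List ℤ} (hA : u <+: A) (hC : u <+: C)
    (hAB : List.Lex (· < ·) A B) (hBC : List.Lex (· < ·) B C) : u <+: B := by
  induction u generalizing A B C with
  | nil => simp
  | cons a u ih =>
    obtain ⟨A, rfl⟩ := hA
    obtain ⟨C, rfl⟩ := hC
    simp only [List.cons_append] at hAB hBC
    cases hAB with
    | cons h =>
      cases hBC with
      | cons h' =>
        simpa using ih (List.prefix_append u A) (List.prefix_append u C) h h'
      | rel h' => exact absurd h' (lt_irrefl _)
    | rel h =>
      cases hBC with
      | cons h' => exact absurd h (lt_irrefl _)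
      | rel h' => exact absurd (h.trans h') (lt_irrefl _)

theorem exists_adjacent_change (Q : ℕ → Prop) {i j : ℕ} (hij : i ≤ j) (h : ¬(Q i ↔ Q j)) :
    ∃ x, i < x ∧ x ≤ j ∧ ¬(Q (x - 1) ↔ Q x) := by
  induction j, hij using Nat.le_induction with
  | base => exact absurd Iff.rfl h
  | succ j hj ih =>
    by_cases hQ : Q i ↔ Q j
    · exact ⟨j + 1, by omega, le_rfl, by simpa [← hQ] using h⟩
    · obtain ⟨x, h1, h2, h3⟩ := ih hQ
      exact ⟨x, h1, by omega, h3⟩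

theorem bIdx_spec (L : ℕ → ℤ) {x : ℕ} (hx : 1 < x) :
    1 ≤ bIdx L x ∧ bIdx L x < x ∧ ∀ y, bIdx L x < y → y < x → L x ≤ L y := by
  have hbdd : BddAbove {y : ℕ | (1 ≤ y ∧ y < x ∧ L y < L x) ∨ y = 1} :=
    ⟨x, by rintro y (h | h) <;> omega⟩
  have hmem := Nat.sSup_mem (s := {y : ℕ | (1 ≤ y ∧ y < x ∧ L y < L x) ∨ y = 1})
    ⟨1, Or.inr rfl⟩ hbdd
  have hone : 1 ≤ bIdx L x := le_csSup hbdd (Or.inr rfl)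
  refine ⟨hone, ?_, fun y hy hyx => ?_⟩
  · rcases hmem with h | h
    · exact h.2.1
    · unfold bIdx; omega
  · by_contra! hlt
    exact absurd (le_csSup hbdd (Or.inl ⟨by omega, hyx, hlt⟩)) (not_le.2 hy)

theorem eIdx_spec (L : ℕ → ℤ) {n x : ℕ} (hx : x ≤ n) :
    x < eIdx L n x ∧ eIdx L n x ≤ n + 1 ∧ ∀ y, x < y → y < eIdx L n x → L x ≤ L y := by
  have hmem := Nat.sInf_mem (s := {y : ℕ | (x < y ∧ y ≤ n ∧ L y < L x) ∨ y = n + 1})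
    ⟨n + 1, Or.inr rfl⟩
  have hle : eIdx L n x ≤ n + 1 := Nat.sInf_le (Or.inr rfl)
  refine ⟨?_, hle, fun y hy hye => ?_⟩
  · rcases hmem with h | h
    · exact h.1
    · unfold eIdx; omega
  · by_contra! hlt
    exact absurd (Nat.sInf_le (Or.inl ⟨hy, by omega, hlt⟩)) (not_le.2 hye)

theorem exists_eq_Candt {BWT w : ℕ → ℤ} {c : ℤ} {a a' : ℕ}
    (h : ∃ p : ℕ, a ≤ p ∧ p < a' ∧ BWT p = c ∧ 0 ≤ w p) :
    ∃ p : ℕ, (p : ℤ) = Candt BWT w c a a' ∧ a ≤ p ∧ p < a' ∧ BWT p = c := by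
  have hmax := Nat.sSup_mem
    (s := {m : ℕ | ∃ q : ℕ, a ≤ q ∧ q < a' ∧ BWT q = c ∧ 0 ≤ w q ∧ (m : ℤ) = w q}) (by
      obtain ⟨p, h1, h2, h3, h4⟩ := h
      exact ⟨(w p).toNat, p, h1, h2, h3, h4, Int.toNat_of_nonneg h4⟩) (by
      refine Set.Finite.bddAbove (((Set.finite_Ico a a').image fun q => (w q).toNat).subset ?_)
      rintro m ⟨q, h1, h2, _, _, h5⟩
      exact ⟨q, ⟨h1, h2⟩, by simp [← h5]⟩)
  obtain ⟨q, h1, h2, h3, _, h5⟩ := hmax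
  have hmem := Nat.sInf_mem
    (s := {p : ℕ | a ≤ p ∧ p < a' ∧ BWT p = c ∧ w p = wMax BWT w c a a'})
    ⟨q, h1, h2, h3, h5.symm⟩
  exact ⟨_, by rw [Candt, if_pos h], hmem.1, hmem.2.1, hmem.2.2.1⟩

section Setup

variable {n σ : ℕ} {T : ℕ → ℤ} {dollar : ℤ} {SA : ℕ → ℕ} {BWT LCP w : ℕ → ℤ}

theorem TextSetup.last_notMem_seg (h : TextSetup n σ T dollar) {m : ℕ} (hm : m < n) :
    T n ∉ seg T 1 m := by
  simp only [seg, List.mem_map, List.mem_range, not_exists, not_and]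
  intro k hk
  rw [h.hTn]
  exact h.hTne _ (by omega) (by omega)

theorem reverse_prefix_sfx_Trev_iff {s : List ℤ} {p : ℕ}
    (hs : T n ∉ s) (hpn : p ≤ n) :
    s.reverse <+: sfx (Trev T n) n p ↔ s <:+ seg T 1 (n - p) := by
  rw [sfx_Trev T hpn, List.prefix_concat_iff, List.reverse_prefix]
  refine or_iff_right fun heq => hs ?_
  rw [← List.mem_reverse, heq]
  simp

/-- Distinct suffixes of the reversed text cannot both contain the sentinel in a common prefix. -/
theorem TextSetup.last_notMem_of_common_prefix (h : TextSetup n σ T dollar) {v : List ℤ} {p q : ℕ}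
    (hp : 1 ≤ p) (hpn : p ≤ n) (hq : 1 ≤ q) (hqn : q ≤ n) (hpq : p ≠ q)
    (hvp : v <+: sfx (Trev T n) n p) (hvq : v <+: sfx (Trev T n) n q) : T n ∉ v := by
  rw [sfx_Trev T hpn, List.prefix_concat_iff] at hvp
  rw [sfx_Trev T hqn, List.prefix_concat_iff] at hvq
  intro hmem
  rcases hvp with hvp | hvp
  · rcases hvq with hvq | hvq
    · have := congrArg List.length (hvp.symm.trans hvq)
      simp [length_seg] at this
      omega
    · exact h.last_notMem_seg (m := n - q) (by omega) (by simpa using hvq.subset hmem)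
  · exact h.last_notMem_seg (m := n - p) (by omega) (by simpa using hvp.subset hmem)

theorem LCPSetup.prefix_iff_of_length_le (h : LCPSetup n σ T dollar SA LCP) {u : List ℤ} {i j : ℕ}
    (hi : 1 ≤ i) (hij : i ≤ j) (hj : j ≤ n)
    (hL : ∀ y, i < y → y ≤ j → (u.length : ℤ) ≤ LCP y) :
    u <+: sfx (Trev T n) n (SA i) ↔ u <+: sfx (Trev T n) n (SA j) := by
  induction j, hij using Nat.le_induction with
  | base => rfl
  | succ j hij ih =>
    rw [ih (by omega) fun y h1 h2 => hL y h1 (by omega)]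
    have hl := hL (j + 1) (by omega) le_rfl
    rw [h.hLCP (j + 1) (by omega) hj] at hl
    exact prefix_iff_of_length_le_lcpLen (by exact_mod_cast hl)

theorem SASetup.exists_index_of_occursIn (h : SASetup n σ T dollar SA)
    (hBWT : ∀ i, 1 ≤ i → i ≤ n → BWT i = T (n - SA i + 1)) {s : List ℤ} {a : ℤ}
    (ha : OccursIn T n (s ++ [a])) :
    ∃ i, 1 ≤ i ∧ i ≤ n ∧ BWT i = a ∧ s <:+ seg T 1 (n - SA i) := by
  obtain ⟨m, hm, hs, rfl⟩ := occursIn_concat_iff.1 ha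
  obtain ⟨i, h1, h2, h3⟩ := h.hSAsurj (n - m) (by omega) (by omega)
  have h4 : n - SA i = m := by omega
  exact ⟨i, h1, h2, by rw [hBWT i h1 h2, h4], by rwa [h4]⟩

theorem FullSetup.weight_nonneg (h : FullSetup n σ T dollar SA BWT LCP w) {x : ℕ} (hx : 1 ≤ x)
    (hxn : x ≤ n) (hrb : RunBoundary BWT n x) {s : List ℤ} (hs : RightMax T n σ s)
    (hsx : s <:+ seg T 1 (n - SA x)) : 0 ≤ w x := by
  obtain ⟨t, -, -, ht⟩ := (h.hwRB x hx hxn hrb ⟨s, hs, hsx⟩).1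
  rw [ht]
  positivity

/-- Occurrences of a right-maximal `s` form an interval of the suffix array, which for a
right-extension `c` of `s` contains a run start with `c` on exactly one side. -/
theorem FullSetup.exists_run_start (h : FullSetup n σ T dollar SA BWT LCP w) {s : List ℤ} {c : ℤ}
    (hs : RightMax T n σ s) (hc : OccursIn T n (s ++ [c])) :
    ∃ x, 1 < x ∧ x ≤ n ∧ ¬(BWT (x - 1) = c ↔ BWT x = c) ∧
      s <:+ seg T 1 (n - SA (x - 1)) ∧ s <:+ seg T 1 (n - SA x) := by
  obtain ⟨i, hi1, hin, hic, hi⟩ := h.exists_index_of_occursIn h.hBWT hc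
  obtain ⟨d, hdc, hd⟩ : ∃ d, d ≠ c ∧ OccursIn T n (s ++ [d]) := by
    obtain ⟨a, b, hab, -, -, -, -, ha, hb⟩ := hs
    by_cases hac : a = c
    · exact ⟨b, fun hbc => hab (hac.trans hbc.symm), hb⟩
    · exact ⟨a, hac, ha⟩
  obtain ⟨j, hj1, hjn, hjd, hj⟩ := h.exists_index_of_occursIn h.hBWT hd
  have hn : T n ∉ s := fun hmem =>
    h.last_notMem_seg (m := n - SA i) (by have := h.hSAmem i hi1 hin; omega) (hi.subset hmem)
  have hchange : ¬(BWT i = c ↔ BWT j = c) := by simp [hic, hjd, hdc]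
  clear hic hjd
  wlog hij : i ≤ j generalizing i j
  · exact this j hj1 hjn hj i hi1 hin hi (fun h' => hchange h'.symm) (by omega)
  have hbetween : ∀ k, i ≤ k → k ≤ j → s <:+ seg T 1 (n - SA k) := by
    intro k hik hkj
    rcases hik.eq_or_lt with rfl | hik
    · exact hi
    rcases hkj.eq_or_lt with rfl | hkj
    · exact hj
    rw [← reverse_prefix_sfx_Trev_iff hn (h.hSAmem _ (by omega) (by omega)).2] at hi hj ⊢
    exact prefix_of_lex_of_lex hi hj (h.hSAord i k hi1 hik (by omega))
      (h.hSAord k j (by omega) hkj hjn)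
  obtain ⟨x, h1, h2, h3⟩ := exists_adjacent_change (fun k => BWT k = c) hij hchange
  exact ⟨x, by omega, by omega, h3, hbetween _ (by omega) (by omega), hbetween _ h1.le h2⟩

theorem FullSetup.rightMax_of_suffix (h : FullSetup n σ T dollar SA BWT LCP w) {s : List ℤ}
    {i j : ℕ} (hi : 1 ≤ i) (hin : i ≤ n) (hj : 1 ≤ j) (hjn : j ≤ n) (hne : BWT i ≠ BWT j)
    (hsi : s <:+ seg T 1 (n - SA i)) (hsj : s <:+ seg T 1 (n - SA j)) : RightMax T n σ s := by
  have hI := h.hSAmem i hi hin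
  have hJ := h.hSAmem j hj hjn
  have hTi := h.hT (n - SA i + 1) (by omega) (by omega)
  have hTj := h.hT (n - SA j + 1) (by omega) (by omega)
  rw [h.hBWT i hi hin, h.hBWT j hj hjn] at hne
  exact ⟨_, _, hne, hTi.1, hTi.2, hTj.1, hTj.2,
    occursIn_concat_iff.2 ⟨_, by omega, hsi, rfl⟩, occursIn_concat_iff.2 ⟨_, by omega, hsj, rfl⟩⟩

end Setup

/-- The set `FullL` is suffixient for the text `T[1..n]`. -/
theorem stmt4 (n σ : ℕ) (T : ℕ → ℤ) (dollar : ℤ) (SA : ℕ → ℕ) (BWT LCP w : ℕ → ℤ)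
    (hsetup : FullSetup n σ T dollar SA BWT LCP w) :
    Suffixient T n σ (FullL n SA BWT LCP w) := by
  intro s hs c _ _ hc
  induction hk : n - s.length using Nat.strong_induction_on generalizing s with
  | _ k ih =>
  subst hk
  obtain ⟨x, hx1, hxn, hxc, hsx', hsx⟩ := hsetup.exists_run_start hs hc
  have hne : BWT x ≠ BWT (x - 1) := fun heq => hxc (by rw [heq])
  have hS := hsetup.hSAmem x (by omega) hxn
  have hS' := hsetup.hSAmem (x - 1) (by omega) (by omega)
  have hSne : SA (x - 1) ≠ SA x := fun heq => by
    have := hsetup.hSAinj _ _ (by omega) (by omega) (by omega) hxn heq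
    omega
  have hns : T n ∉ s := fun hmem =>
    hsetup.last_notMem_seg (m := n - SA x) (by omega) (hsx.subset hmem)
  have hpx := (reverse_prefix_sfx_Trev_iff hns hS.2).2 hsx
  have hpx' := (reverse_prefix_sfx_Trev_iff hns hS'.2).2 hsx'
  have hLx := hsetup.hLCP x hx1 hxn
  obtain ⟨v, hv, hvx', hvx⟩ := exists_common_prefix_length_eq_lcpLen
    (sfx (Trev T n) n (SA (x - 1))) (sfx (Trev T n) n (SA x))
  have hlen := length_le_lcpLen hpx' hpx
  rw [← hv] at hLx hlen
  have hcx : BWT x = c ∨ BWT (x - 1) = c := by tauto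
  rcases hlen.lt_or_eq with hlt | heq
  · -- a longer right-maximal string extends `s` to the left
    have hnv : T n ∉ v.reverse := by
      simpa using hsetup.last_notMem_of_common_prefix hS'.1 hS'.2 hS.1 hS.2 hSne hvx' hvx
    have hsv : s <:+ v.reverse := by
      rw [← List.reverse_prefix, List.reverse_reverse]
      exact List.prefix_of_prefix_length_le hpx hvx hlen
    rw [← v.reverse_reverse] at hvx hvx'
    rw [reverse_prefix_sfx_Trev_iff hnv hS.2] at hvx
    rw [reverse_prefix_sfx_Trev_iff hnv hS'.2] at hvx'
    have hvc : OccursIn T n (v.reverse ++ [c]) := by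
      rw [occursIn_concat_iff]
      rcases hcx with h | h
      · exact ⟨n - SA x, by omega, hvx, by rw [← h, hsetup.hBWT x (by omega) hxn]⟩
      · exact ⟨n - SA (x - 1), by omega, hvx',
          by rw [← h, hsetup.hBWT (x - 1) (by omega) (by omega)]⟩
    have hvl := hvx.length_le
    rw [List.length_reverse] at hlt
    rw [length_seg, List.length_reverse] at hvl
    obtain ⟨y, hy, hsuf⟩ := ih (n - v.reverse.length) (by rw [List.length_reverse]; omega)
      v.reverse (hsetup.rightMax_of_suffix (by omega) hxn (by omega) (by omega) hne hvx hvx')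
      hvc rfl
    obtain ⟨t, ht⟩ := hsv
    exact ⟨y, hy, List.IsSuffix.trans ⟨t, by rw [← List.append_assoc, ht]⟩ hsuf⟩
  · obtain ⟨hb1, hbx, hb⟩ := bIdx_spec LCP hx1
    obtain ⟨hex, hen, he⟩ := eIdx_spec LCP hxn
    have hcand : ∃ p, bIdx LCP x ≤ p ∧ p < eIdx LCP n x ∧ BWT p = c ∧ 0 ≤ w p := by
      rcases hcx with h | h
      · exact ⟨x, hbx.le, hex, h,
          hsetup.weight_nonneg (by omega) hxn (Or.inl ⟨hx1, hne⟩) hs hsx⟩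
      · refine ⟨x - 1, by omega, by omega, h, hsetup.weight_nonneg (by omega) (by omega)
          (Or.inr ⟨by omega, ?_⟩) hs hsx'⟩
        rw [Nat.sub_add_cancel (by omega)]
        exact hne.symm
    obtain ⟨p, hp, hbp, hpe, hpc⟩ := exists_eq_Candt hcand
    refine ⟨n - SA p + 1, ⟨x, hx1, hxn, hne, c, hcx.imp Eq.symm Eq.symm, p, hp, rfl⟩, ?_⟩
    rw [suffix_concat_iff_of_seg, ← hsetup.hBWT p (by omega) (by omega)]
    refine ⟨?_, hpc⟩
    rw [← reverse_prefix_sfx_Trev_iff hns (hsetup.hSAmem p (by omega) (by omega)).2]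
    rw [← heq] at hLx
    rcases le_total p x with hpx2 | hpx2
    · refine (hsetup.prefix_iff_of_length_le (by omega) hpx2 hxn fun y h1 h2 => ?_).2 hpx
      rcases h2.eq_or_lt with rfl | h2
      · exact hLx.ge
      · exact hLx.ge.trans (hb y (by omega) h2)
    · exact (hsetup.prefix_iff_of_length_le (by omega) hpx2 (by omega) fun y h1 h2 =>
        hLx.ge.trans (he y h1 (by omega))).1 hpx
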